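/- For every n ≥ 3, the intersection I_0 ∩ I_1 ∩ ⋯ ∩ I_n is contained in L ∩ (𝔦_0, …, 𝔦_n)_Σ; that is, every element of I_0 ∩ ⋯ ∩ I_n has image under the canonical map L → U(L) lying in the symmetric product ideal (𝔦_0, …, 𝔦_n)_Σ of the universal enveloping algebra U(L). -/

import Mathlib

/-- The elements `x_0, …, x_n` of the free Lie `ℤ`-algebra `L` on `x_0, …, x_{n-1}`,
with `x_n := -(x_0 + ⋯ + x_{n-1})`, so that `x_0 + x_1 + ⋯ + x_n = 0`. -/
noncomputable def xL (n : ℕ) (i : Fin (n + 1)) : FreeLieAlgebra ℤ (Fin n) :=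
  if h : (i : ℕ) < n then FreeLieAlgebra.of ℤ ⟨i, h⟩
  else -(∑ j : Fin n, FreeLieAlgebra.of ℤ j)

/-- `I_i`, the Lie ideal of `L` generated by `x_i`. -/
noncomputable def ILie (n : ℕ) (i : Fin (n + 1)) :
    LieIdeal ℤ (FreeLieAlgebra ℤ (Fin n)) :=
  LieSubmodule.lieSpan ℤ (FreeLieAlgebra ℤ (Fin n)) {xL n i}

/-- `𝔦_i`, the two-sided ideal of `U(L)` generated by the image of `x_i`,
viewed as a `ℤ`-submodule of `U(L)`. -/
noncomputable def iIdeal (n : ℕ) (i : Fin (n + 1)) :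
    Submodule ℤ (UniversalEnvelopingAlgebra ℤ (FreeLieAlgebra ℤ (Fin n))) :=
  Submodule.span ℤ
    {v | ∃ a b : UniversalEnvelopingAlgebra ℤ (FreeLieAlgebra ℤ (Fin n)),
      v = a * (UniversalEnvelopingAlgebra.ι ℤ (xL n i)) * b}

/-- The symmetric product `(𝔦_0, …, 𝔦_n)_Σ = Σ_ρ 𝔦_{ρ(0)} ⋯ 𝔦_{ρ(n)}`. -/
noncomputable def symProdLie (n : ℕ) :
    Submodule ℤ (UniversalEnvelopingAlgebra ℤ (FreeLieAlgebra ℤ (Fin n))) :=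
  ⨆ ρ : Equiv.Perm (Fin (n + 1)),
    (List.ofFn fun k : Fin (n + 1) => iIdeal n (ρ k)).prod

namespace SymP

open Module

variable {X : Type*}

noncomputable def W (l : List X) : FreeAlgebra ℤ X := (l.map (FreeAlgebra.ι ℤ)).prod

noncomputable def bW : Basis (List X) ℤ (FreeAlgebra ℤ X) := FreeAlgebra.basisFreeMonoid ℤ X

lemma W_nil : W ([] : List X) = 1 := rfl
lemma W_cons (a : X) (l : List X) : W (a :: l) = FreeAlgebra.ι ℤ a * W l := by simp [W]
lemma W_append (a l : List X) : W (a ++ l) = W a * W l := by simp [W]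
lemma W_single (a : X) : W [a] = FreeAlgebra.ι ℤ a := by simp [W]

lemma bW_apply (l : List X) : bW l = W l := by
  have h : bW l = FreeAlgebra.equivMonoidAlgebraFreeMonoid.symm
      (MonoidAlgebra.of ℤ (FreeMonoid X) (FreeMonoid.ofList l)) := rfl
  rw [h]
  induction l with
  | nil => rw [W_nil, FreeMonoid.ofList_nil, map_one, map_one]
  | cons a l ih =>
    rw [W_cons, FreeMonoid.ofList_cons, map_mul, map_mul, ih rfl]
    congr 1
    simp [FreeAlgebra.equivMonoidAlgebraFreeMonoid]
    exact one_smul _ _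

noncomputable def Fl (P : List X → Prop) : Submodule ℤ (FreeAlgebra ℤ X) :=
  Submodule.span ℤ (W '' {l | P l})

noncomputable def yS (S : Finset X) : FreeAlgebra ℤ X := ∑ i ∈ S, FreeAlgebra.ι ℤ i

noncomputable def J (y : FreeAlgebra ℤ X) : Submodule ℤ (FreeAlgebra ℤ X) :=
  Submodule.span ℤ {v | ∃ l r : List X, v = W l * y * W r}

lemma W_mem_Fl {P : List X → Prop} {l : List X} (h : P l) : W l ∈ Fl P :=
  Submodule.subset_span ⟨l, h, rfl⟩

lemma mem_J (y : FreeAlgebra ℤ X) (l r : List X) : W l * y * W r ∈ J y :=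
  Submodule.subset_span ⟨l, r, rfl⟩

lemma Fl_map {M : Type*} [AddCommMonoid M] [Module ℤ M] {P : List X → Prop}
    (φ : FreeAlgebra ℤ X →ₗ[ℤ] M) (N : Submodule ℤ M) (h : ∀ l, P l → φ (W l) ∈ N)
    {f : FreeAlgebra ℤ X} (hf : f ∈ Fl P) : φ f ∈ N := by
  have : Fl P ≤ N.comap φ := by
    refine Submodule.span_le.2 ?_
    rintro _ ⟨l, hl, rfl⟩
    exact h l hl
  exact this hf

lemma Fl_ext {M : Type*} [AddCommMonoid M] [Module ℤ M] {P : List X → Prop}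
    (φ ψ : FreeAlgebra ℤ X →ₗ[ℤ] M) (h : ∀ l, P l → φ (W l) = ψ (W l))
    {f : FreeAlgebra ℤ X} (hf : f ∈ Fl P) : φ f = ψ f := by
  have : Fl P ≤ LinearMap.eqLocus φ ψ := by
    refine Submodule.span_le.2 ?_
    rintro _ ⟨l, hl, rfl⟩
    exact h l hl
  exact this hf

lemma J_map {M : Type*} [AddCommMonoid M] [Module ℤ M] {y : FreeAlgebra ℤ X}
    (φ : FreeAlgebra ℤ X →ₗ[ℤ] M) (N : Submodule ℤ M) (h : ∀ l r, φ (W l * y * W r) ∈ N)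
    {f : FreeAlgebra ℤ X} (hf : f ∈ J y) : φ f ∈ N := by
  have : J y ≤ N.comap φ := by
    refine Submodule.span_le.2 ?_
    rintro _ ⟨l, r, rfl⟩
    exact h l r
  exact this hf

lemma mem_Fl_iff {P : List X → Prop} {f : FreeAlgebra ℤ X} :
    f ∈ Fl P ↔ ∀ l, bW.repr f l ≠ 0 → P l := by
  have : Fl P = Submodule.span ℤ (bW '' {l | P l}) := by
    unfold Fl; congr 1; ext v; simp [bW_apply]
  rw [this, Basis.mem_span_image]
  constructor
  · intro h l hl
    exact h (by simpa using hl)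
  · intro h l hl
    exact h l (by simpa using hl)

lemma Fl_mono {P Q : List X → Prop} (h : ∀ l, P l → Q l) : Fl P ≤ Fl Q :=
  Submodule.span_mono (Set.image_mono h)

lemma Fl_true (f : FreeAlgebra ℤ X) : f ∈ Fl (fun _ => True) := mem_Fl_iff.2 (by simp)

lemma Fl_sup {P Q : List X → Prop} {f : FreeAlgebra ℤ X} (h : f ∈ Fl (fun l => P l ∨ Q l)) :
    ∃ g ∈ Fl P, ∃ k ∈ Fl Q, g + k = f := by
  rw [← Submodule.mem_sup]
  refine Fl_map LinearMap.id _ ?_ h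
  rintro l (hl | hl)
  · exact Submodule.mem_sup_left (W_mem_Fl hl)
  · exact Submodule.mem_sup_right (W_mem_Fl hl)

lemma Fl_mul {P Q R : List X → Prop} (h : ∀ l r, P l → Q r → R (l ++ r))
    {f g : FreeAlgebra ℤ X} (hf : f ∈ Fl P) (hg : g ∈ Fl Q) : f * g ∈ Fl R := by
  refine Fl_map (LinearMap.mulRight ℤ g) _ (fun l hl => ?_) hf
  refine Fl_map (LinearMap.mulLeft ℤ (W l)) _ (fun r hr => ?_) hg
  rw [LinearMap.mulLeft_apply, ← W_append]
  exact W_mem_Fl (h l r hl hr)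

lemma mulmul_mem {P Q : List X → Prop} (N : Submodule ℤ (FreeAlgebra ℤ X)) (y : FreeAlgebra ℤ X)
    (h : ∀ l r, P l → Q r → W l * y * W r ∈ N)
    {f g : FreeAlgebra ℤ X} (hf : f ∈ Fl P) (hg : g ∈ Fl Q) : f * y * g ∈ N := by
  refine Fl_map (LinearMap.mulRight ℤ g ∘ₗ LinearMap.mulRight ℤ y) N (fun l hl => ?_) hf
  exact Fl_map (LinearMap.mulLeft ℤ (W l * y)) N (fun r hr => h l r hl hr) hg

lemma J_mul (y a b : FreeAlgebra ℤ X) {f : FreeAlgebra ℤ X} (hf : f ∈ J y) : a * f * b ∈ J y := by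
  have := J_map ((LinearMap.mulRight ℤ b).comp (LinearMap.mulLeft ℤ a)) (J y) (fun l r => ?_) hf
  · simpa using this
  have := mulmul_mem (J y) y (fun l r _ _ => mem_J y l r) (Fl_true (a * W l)) (Fl_true (W r * b))
  simpa [mul_assoc] using this

lemma J_hom (φ : FreeAlgebra ℤ X →ₐ[ℤ] FreeAlgebra ℤ X) {y f : FreeAlgebra ℤ X} (hf : f ∈ J y) :
    φ f ∈ J (φ y) := by
  refine J_map φ.toLinearMap (J (φ y)) (fun l r => ?_) hf
  have : φ y ∈ J (φ y) := by simpa [W_nil] using mem_J (φ y) [] []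
  change φ (W l * y * W r) ∈ J (φ y)
  rw [map_mul, map_mul]
  exact J_mul (φ y) (φ (W l)) (φ (W r)) this

lemma J_zero {f : FreeAlgebra ℤ X} (hf : f ∈ J (0 : FreeAlgebra ℤ X)) : f = 0 := by
  simpa using J_map LinearMap.id ⊥ (fun l r => by simp) hf

set_option linter.unusedSectionVars false
variable [DecidableEq X]

lemma J_ι (j : X) : J (FreeAlgebra.ι ℤ j) ≤ Fl (fun l => j ∈ l) := by
  refine Submodule.span_le.2 ?_
  rintro _ ⟨l, r, rfl⟩
  rw [← W_single, ← W_append, ← W_append]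
  exact W_mem_Fl (by simp)

lemma Fl_J_ι (j : X) : Fl (fun l => j ∈ l) ≤ J (FreeAlgebra.ι ℤ j) := by
  refine Submodule.span_le.2 ?_
  rintro _ ⟨l, hl, rfl⟩
  obtain ⟨a, b, rfl⟩ := List.append_of_mem hl
  rw [W_append, W_cons, ← mul_assoc]
  exact mem_J _ a b

noncomputable def Sm (S : Finset X) : Submodule ℤ (FreeAlgebra ℤ X) :=
  Submodule.span ℤ {v | ∃ l r : List X, (l ++ r).toFinset = S ∧ v = W l * yS S * W r}

lemma mem_Sm {S : Finset X} {l r : List X} (h : (l ++ r).toFinset = S) :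
    W l * yS S * W r ∈ Sm S := Submodule.subset_span ⟨l, r, h, rfl⟩

lemma Sm_le_J (S : Finset X) : Sm S ≤ J (yS S) := by
  refine Submodule.span_mono ?_
  rintro _ ⟨l, r, -, rfl⟩
  exact ⟨l, r, rfl⟩

/-- left derivative -/
noncomputable def δ (i : X) : FreeAlgebra ℤ X →ₗ[ℤ] FreeAlgebra ℤ X :=
  bW.constr ℤ (fun l => match l with
    | [] => 0
    | a :: t => if a = i then W t else 0)

lemma δ_nil (i : X) : δ i (1 : FreeAlgebra ℤ X) = 0 := by
  rw [← W_nil, ← bW_apply, δ, Basis.constr_basis]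

lemma δ_W (i a : X) (t : List X) : δ i (W (a :: t)) = if a = i then W t else 0 := by
  rw [← bW_apply, δ, Basis.constr_basis]

lemma δ_mul (i a : X) (f : FreeAlgebra ℤ X) :
    δ i (FreeAlgebra.ι ℤ a * f) = if a = i then f else 0 := by
  have := Fl_map (δ i ∘ₗ LinearMap.mulLeft ℤ (FreeAlgebra.ι ℤ a) - if a = i then LinearMap.id else 0)
    ⊥ (fun l _ => ?_) (Fl_true f)
  · rw [Submodule.mem_bot, LinearMap.sub_apply, sub_eq_zero] at this
    split_ifs at this ⊢ <;> simpa using this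
  · rw [Submodule.mem_bot, LinearMap.sub_apply, sub_eq_zero, LinearMap.comp_apply,
      LinearMap.mulLeft_apply, ← W_cons, δ_W]
    split_ifs <;> simp

lemma δ_coord (i : X) (f : FreeAlgebra ℤ X) (l : List X) :
    bW.repr (δ i f) l = bW.repr f (i :: l) := by
  refine Fl_ext (bW.coord l ∘ₗ δ i) (bW.coord (i :: l)) (fun w _ => ?_) (Fl_true f)
  rw [LinearMap.comp_apply]
  cases w with
  | nil => rw [W_nil, δ_nil, ← W_nil, ← bW_apply]; simp
  | cons a t =>
    rw [δ_W, ← bW_apply (a :: t)]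
    split_ifs with h
    · subst h
      rw [← bW_apply]; simp [Finsupp.single_apply]
    · simp [h]

lemma δ_y {S : Finset X} {i : X} (hi : i ∈ S) (f : FreeAlgebra ℤ X) : δ i (yS S * f) = f := by
  simp [yS, Finset.sum_mul, δ_mul, hi]

lemma δ_sub_J {S : Finset X} {i j : X} (hi : i ∈ S) (hj : j ∈ S) {f : FreeAlgebra ℤ X}
    (hf : f ∈ J (yS S)) : δ i f - δ j f ∈ J (yS S) := by
  refine J_map (δ i - δ j) _ (fun l r => ?_) hf
  cases l with
  | nil => simp [W_nil, δ_y hi, δ_y hj]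
  | cons a t =>
    rw [W_cons, mul_assoc, mul_assoc, LinearMap.sub_apply, δ_mul, δ_mul, ← mul_assoc]
    refine Submodule.sub_mem _ ?_ ?_ <;> split_ifs
    all_goals first | exact mem_J _ _ _ | exact Submodule.zero_mem _

lemma sum_δ {S : Finset X} {f : FreeAlgebra ℤ X} (hf : f ∈ Fl (fun l => ∃ a t, l = a :: t ∧ a ∈ S)) :
    f = ∑ i ∈ S, FreeAlgebra.ι ℤ i * δ i f := by
  have := Fl_map (LinearMap.id - ∑ i ∈ S, LinearMap.mulLeft ℤ (FreeAlgebra.ι ℤ i) ∘ₗ δ i)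
    ⊥ (fun l hl => ?_) hf
  · rw [Submodule.mem_bot, LinearMap.sub_apply, sub_eq_zero] at this
    simpa [LinearMap.sum_apply] using this
  · obtain ⟨a, t, rfl, ha⟩ := hl
    simp [LinearMap.sum_apply, W_cons, δ_mul, ha]

/-- substitute x_i ↦ z -/
noncomputable def sb (i : X) (z : FreeAlgebra ℤ X) : FreeAlgebra ℤ X →ₐ[ℤ] FreeAlgebra ℤ X :=
  FreeAlgebra.lift ℤ (fun j => if j = i then z else FreeAlgebra.ι ℤ j)

lemma sb_ι (i j : X) (z : FreeAlgebra ℤ X) :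
    sb i z (FreeAlgebra.ι ℤ j) = if j = i then z else FreeAlgebra.ι ℤ j := by
  simp [sb]

lemma sb_fix (i : X) (z : FreeAlgebra ℤ X) {f : FreeAlgebra ℤ X} (hf : f ∈ Fl (fun l => i ∉ l)) :
    sb i z f = f := by
  refine Fl_ext (sb i z).toLinearMap LinearMap.id (fun l hl => ?_) hf
  change sb i z (W l) = W l
  induction l with
  | nil => simp [W_nil]
  | cons a t ih =>
    simp only [List.mem_cons, not_or] at hl
    rw [W_cons, map_mul, sb_ι, if_neg (Ne.symm hl.1), ih hl.2]

lemma sb_zero (i : X) {f : FreeAlgebra ℤ X} (hf : f ∈ Fl (fun l => i ∈ l)) :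
    sb i 0 f = 0 := by
  have := J_hom (sb i 0) (Fl_J_ι i hf)
  rw [sb_ι, if_pos rfl] at this
  exact J_zero this

lemma sb_y {S : Finset X} {i : X} (hi : i ∈ S) (z : FreeAlgebra ℤ X) :
    sb i z (yS S) = z + yS (S.erase i) := by
  unfold yS
  rw [map_sum, ← Finset.add_sum_erase _ _ hi, sb_ι, if_pos rfl]
  congr 1
  refine Finset.sum_congr rfl (fun j hj => ?_)
  rw [sb_ι, if_neg (Finset.ne_of_mem_erase hj)]

lemma y_erase {S : Finset X} {i : X} (hi : i ∈ S) :
    yS S = FreeAlgebra.ι ℤ i + yS (S.erase i) := (Finset.add_sum_erase _ _ hi).symm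

lemma J_no {S : Finset X} {i : X} (hi : i ∈ S) {f : FreeAlgebra ℤ X} (hf : f ∈ Fl (fun l => i ∉ l))
    (hJ : f ∈ J (yS S)) : f = 0 := by
  have := J_hom (sb i (-yS (S.erase i))) hJ
  rw [sb_y hi, neg_add_cancel, sb_fix i _ hf] at this
  exact J_zero this

lemma sb_sub {S : Finset X} (i : X) {z : FreeAlgebra ℤ X} (P : X → Prop)
    (hz : z ∈ Fl (fun l => l.toFinset ⊆ S))
    (hP : ∀ j, P j → j ≠ i) {l : List X} (hl : l.toFinset ⊆ S) :
    sb i z (W l) ∈ Fl (fun w => w.toFinset ⊆ S ∧ ∀ j ∈ l, P j → j ∈ w) := by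
  induction l with
  | nil => rw [W_nil, map_one, ← W_nil]; exact W_mem_Fl (by simp)
  | cons a t ih =>
    simp only [List.toFinset_cons, Finset.insert_subset_iff] at hl
    rw [W_cons, map_mul, sb_ι]
    split_ifs with h
    · refine Fl_mul ?_ hz (ih hl.2)
      rintro u v hu ⟨hv, hv'⟩
      refine ⟨by rw [List.toFinset_append]; exact Finset.union_subset hu hv, ?_⟩
      intro j hj hjP
      rcases List.mem_cons.1 hj with rfl | hj
      · exact absurd h (hP _ hjP)
      · exact List.mem_append_right _ (hv' j hj hjP)
    · rw [← W_single]
      refine Fl_mul (P := fun w => w = [a]) ?_ (W_mem_Fl rfl) (ih hl.2)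
      rintro u v rfl ⟨hv, hv'⟩
      refine ⟨by
        rw [List.toFinset_append]
        exact Finset.union_subset (by simpa using hl.1) hv, ?_⟩
      intro j hj hjP
      rcases List.mem_cons.1 hj with rfl | hj
      · simp
      · exact List.mem_append_right _ (hv' j hj hjP)

lemma y_mem (S : Finset X) : yS S ∈ Fl (fun l => l.toFinset ⊆ S) := by
  refine Submodule.sum_mem _ (fun i hi => ?_)
  rw [← W_single]
  exact W_mem_Fl (by simpa using hi)

lemma lem2 {S : Finset X} {i : X} (hi : i ∈ S) {f : FreeAlgebra ℤ X}
    (hf : f ∈ Fl (fun l => l.toFinset = S)) (hJ : f ∈ J (yS S)) :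
    FreeAlgebra.ι ℤ i * f ∈ Sm S := by
  set z : FreeAlgebra ℤ X := FreeAlgebra.ι ℤ i - yS (S.erase i) with hz
  have hzS : z ∈ Fl (fun l => l.toFinset ⊆ S) := by
    refine Submodule.sub_mem _ ?_ ?_
    · rw [← W_single]; exact W_mem_Fl (by simpa using hi)
    · exact Fl_mono (fun l h => h.trans (Finset.erase_subset _ _)) (y_mem (S.erase i))
  have h1 : sb i z f ∈ Fl (fun l => l.toFinset = S) := by
    have hsub : sb i z f ∈ Fl (fun l => l.toFinset ⊆ S) := by
      refine Fl_map (sb i z).toLinearMap _ (fun l hl => ?_) hf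
      exact Fl_mono (fun w hw => hw.1) (sb_sub i (fun _ => False) hzS (by simp) hl.subset)
    have hj : ∀ j ∈ S, sb i z f ∈ Fl (fun l => j ∈ l) := by
      intro j hj
      apply J_ι
      by_cases hji : j = i
      · subst hji
        have := J_hom (sb j z) hJ
        rwa [sb_y hj, hz, sub_add_cancel] at this
      · have := J_hom (sb i z) (Fl_J_ι j (Fl_mono (fun l hl => ?_) hf))
        · rwa [sb_ι, if_neg hji] at this
        · rw [← List.mem_toFinset, hl]; exact hj
    rw [mem_Fl_iff] at hsub ⊢
    intro l hl
    refine (hsub l hl).antisymm (fun j hjS => ?_)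
    exact List.mem_toFinset.2 (mem_Fl_iff.1 (hj j hjS) l hl)
  have h2 : sb i (yS S) (sb i z f) = f := by
    have : (sb i (yS S)).comp (sb i z) = AlgHom.id ℤ _ := by
      ext j
      simp only [Function.comp, AlgHom.comp_apply, AlgHom.id_apply, sb_ι]
      split_ifs with h
      · subst h
        rw [hz, map_sub, sb_ι, if_pos rfl, sb_fix, y_erase hi, add_sub_cancel_right]
        refine Fl_mono (fun l hl hh => ?_) (y_mem (S.erase j))
        simpa using hl (List.mem_toFinset.2 hh)
      · rw [sb_ι, if_neg h]
    exact DFunLike.congr_fun this f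
  rw [← h2]
  refine Fl_map (LinearMap.mulLeft ℤ (FreeAlgebra.ι ℤ i) ∘ₗ (sb i (yS S)).toLinearMap) _
    (fun w hw => ?_) h1
  have hiw : i ∈ w := by rw [← List.mem_toFinset, hw]; exact hi
  obtain ⟨a, b, rfl⟩ := List.append_of_mem hiw
  rw [List.toFinset_append, List.toFinset_cons] at hw
  have ha : a.toFinset ⊆ S := by rw [← hw]; exact Finset.subset_union_left
  have hb : b.toFinset ⊆ S := by
    rw [← hw]; exact (Finset.subset_insert _ _).trans Finset.subset_union_right
  have hA := sb_sub i (fun j => j ≠ i) (y_mem S) (fun _ h => h) ha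
  have hB := sb_sub i (fun j => j ≠ i) (y_mem S) (fun _ h => h) hb
  have key := mulmul_mem (P := fun w => w.toFinset ⊆ S ∧ i ∈ w ∧ ∀ j ∈ a, j ≠ i → j ∈ w)
    (f := FreeAlgebra.ι ℤ i * sb i (yS S) (W a)) (Sm S) (yS S) (fun l r hl hr => ?_) ?_ hB
  · change FreeAlgebra.ι ℤ i * sb i (yS S) (W (a ++ i :: b)) ∈ Sm S
    simpa [W_append, W_cons, sb_ι, mul_assoc] using key
  · apply mem_Sm
    rw [List.toFinset_append]
    refine (Finset.union_subset hl.1 hr.1).antisymm (fun j hj => ?_)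
    rw [Finset.mem_union, List.mem_toFinset, List.mem_toFinset]
    by_cases hji : j = i
    · subst hji; exact Or.inl hl.2.1
    · rw [← hw] at hj
      simp only [Finset.mem_union, List.mem_toFinset, Finset.mem_insert, hji, false_or] at hj
      exact hj.imp (fun h => hl.2.2 j h hji) (fun h => hr.2 j h hji)
  · rw [← W_single]
    refine Fl_mul (P := fun w => w = [i]) ?_ (W_mem_Fl rfl) hA
    rintro u v rfl ⟨hv, hv'⟩
    refine ⟨?_, by simp, fun j hj hji => List.mem_append_right _ (hv' j hj hji)⟩
    rw [List.toFinset_append]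
    exact Finset.union_subset (by simpa using hi) hv

lemma thmA (n : ℕ) : ∀ S : Finset X, S.card = n → ∀ f : FreeAlgebra ℤ X,
    f ∈ Fl (fun l => l.toFinset = S ∧ S.card < l.length) → f ∈ J (yS S) → f ∈ Sm S := by
  induction n with
  | zero =>
    intro S hS f hf _
    rw [Finset.card_eq_zero] at hS
    subst hS
    refine Fl_map LinearMap.id _ (fun l hl => ?_) hf
    exfalso
    obtain ⟨h1, h2⟩ := hl
    rw [List.toFinset_eq_empty_iff] at h1
    simp [h1] at h2
  | succ n ih =>
    intro S hS f hf hJ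
    -- decomposition of the derivatives
    have hdec : ∀ i ∈ S, δ i f ∈ Fl (fun l => l.toFinset = S ∨
        (l.toFinset = S.erase i ∧ (S.erase i).card < l.length)) := by
      intro i hi
      refine Fl_map (δ i) _ (fun l hl => ?_) hf
      cases l with
      | nil => simp [W_nil, δ_nil]
      | cons a t =>
        rw [δ_W]
        split_ifs with h
        · subst h
          refine W_mem_Fl ?_
          obtain ⟨h1, h2⟩ := hl
          rw [List.toFinset_cons] at h1
          by_cases hat : a ∈ t.toFinset
          · left; rwa [Finset.insert_eq_of_mem hat] at h1
          · right
            rw [← h1, Finset.erase_insert hat]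
            refine ⟨rfl, ?_⟩
            rw [← h1, Finset.card_insert_of_notMem hat] at h2
            simpa using h2
        · exact Submodule.zero_mem _
    have hfs : f = ∑ i ∈ S, FreeAlgebra.ι ℤ i * δ i f := by
      refine sum_δ (Fl_mono (fun l hl => ?_) hf)
      cases l with
      | nil => simp at hl
      | cons a t => exact ⟨a, t, rfl, by rw [← hl.1]; simp⟩
    -- each term can be replaced by a full one
    have hG : ∀ i ∈ S, ∃ G ∈ Fl (fun l : List X => l.toFinset = S),
        FreeAlgebra.ι ℤ i * δ i f - FreeAlgebra.ι ℤ i * G ∈ Sm S := by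
      intro i hi
      obtain ⟨g, hg, h, hh, hgh⟩ := Fl_sup (hdec i hi)
      have hhS : h ∈ Sm (S.erase i) := by
        apply ih _ (by rw [Finset.card_erase_of_mem hi, hS]; rfl) h hh
        by_cases hne : (S.erase i).Nonempty
        · obtain ⟨j, hj⟩ := hne
          have hji := Finset.ne_of_mem_erase hj
          have hjS := Finset.mem_of_mem_erase hj
          have h1 := J_hom (sb i 0) (δ_sub_J hi hjS hJ)
          have h2 : sb i 0 (δ j f) = 0 := by
            apply sb_zero
            refine Fl_mono (fun l hl => ?_) (hdec j hjS)
            rw [← List.mem_toFinset]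
            rcases hl with hl | hl
            · rwa [hl]
            · rw [hl.1]; exact Finset.mem_erase.2 ⟨hji.symm, hi⟩
          have h3 : sb i 0 g = 0 := by
            apply sb_zero
            refine Fl_mono (fun l hl => ?_) hg
            rw [← List.mem_toFinset, hl]; exact hi
          have h4 : sb i 0 h = h := by
            apply sb_fix
            refine Fl_mono (fun l hl => ?_) hh
            rw [← List.mem_toFinset, hl.1]; simp
          rw [sb_y hi, zero_add, map_sub, h2, sub_zero, ← hgh, map_add, h3, h4, zero_add] at h1
          exact h1
        · rw [Finset.not_nonempty_iff_eq_empty] at hne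
          refine Fl_map LinearMap.id _ (fun l hl => ?_) hh
          exfalso
          obtain ⟨h1, h2⟩ := hl
          rw [hne, List.toFinset_eq_empty_iff] at h1
          simp [h1] at h2
      have key : ∃ k ∈ Fl (fun l : List X => l.toFinset = S),
          FreeAlgebra.ι ℤ i * h - FreeAlgebra.ι ℤ i * k ∈ Sm S := by
        refine Submodule.span_induction (p := fun h _ => ∃ k ∈ Fl (fun l : List X => l.toFinset = S),
          FreeAlgebra.ι ℤ i * h - FreeAlgebra.ι ℤ i * k ∈ Sm S) ?_ ?_ ?_ ?_ hhS
        · rintro _ ⟨l, r, hlr, rfl⟩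
          refine ⟨-(W (l ++ i :: r)), Submodule.neg_mem _ (W_mem_Fl ?_), ?_⟩
          · rw [List.toFinset_append] at hlr
            rw [List.toFinset_append, List.toFinset_cons, Finset.union_insert, hlr,
              Finset.insert_erase hi]
          · have : FreeAlgebra.ι ℤ i * (W l * yS (S.erase i) * W r)
                - FreeAlgebra.ι ℤ i * -(W (l ++ i :: r)) = W (i :: l) * yS S * W r := by
              rw [y_erase hi, W_append, W_cons, W_cons]
              noncomm_ring
            rw [this]
            apply mem_Sm
            rw [List.cons_append, List.toFinset_cons, hlr, Finset.insert_erase hi]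
        · exact ⟨0, Submodule.zero_mem _, by simp⟩
        · rintro x y _ _ ⟨k, hk, hk'⟩ ⟨k2, hk2, hk2'⟩
          refine ⟨k + k2, Submodule.add_mem _ hk hk2, ?_⟩
          have := Submodule.add_mem _ hk' hk2'
          convert this using 1
          noncomm_ring
        · rintro c x _ ⟨k, hk, hk'⟩
          refine ⟨c • k, Submodule.smul_mem _ _ hk, ?_⟩
          have := Submodule.smul_mem _ c hk'
          convert this using 1
          rw [mul_smul_comm, mul_smul_comm, smul_sub]
      obtain ⟨k, hk, hk'⟩ := key
      refine ⟨g + k, Submodule.add_mem _ hg hk, ?_⟩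
      rw [← hgh]
      convert hk' using 1
      noncomm_ring
    choose! G hGF hGS using hG
    set f' := ∑ i ∈ S, FreeAlgebra.ι ℤ i * G i with hf'
    have hff : f - f' ∈ Sm S := by
      rw [hfs, hf', ← Finset.sum_sub_distrib]
      exact Submodule.sum_mem _ hGS
    have hJ' : f' ∈ J (yS S) := by
      have := Submodule.sub_mem _ hJ (Sm_le_J S hff)
      rwa [sub_sub_cancel] at this
    have hδ : ∀ i ∈ S, δ i f' = G i := by
      intro i hi
      rw [hf', map_sum]
      simp [δ_mul, hi]
    obtain ⟨e, he⟩ : S.Nonempty := by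
      rw [← Finset.card_pos, hS]; omega
    have hf'' : f' = ∑ i ∈ S, FreeAlgebra.ι ℤ i * (G i - G e) + yS S * G e := by
      rw [hf', yS, Finset.sum_mul, ← Finset.sum_add_distrib]
      refine Finset.sum_congr rfl (fun i _ => ?_)
      noncomm_ring
    have hfin : f' ∈ Sm S := by
      rw [hf'']
      refine Submodule.add_mem _ (Submodule.sum_mem _ (fun i hi => ?_)) ?_
      · refine lem2 hi (Submodule.sub_mem _ (hGF i hi) (hGF e he)) ?_
        have := δ_sub_J hi he hJ'
        rwa [hδ i hi, hδ e he] at this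
      · refine Fl_map (LinearMap.mulLeft ℤ (yS S)) _ (fun l hl => ?_) (hGF e he)
        have := mem_Sm (S := S) (l := []) (r := l) (by simpa using hl)
        simpa [W_nil] using this
    have := Submodule.add_mem _ hff hfin
    rwa [sub_add_cancel] at this

def Good (S : Finset X) (f : FreeAlgebra ℤ X) : Prop :=
  f ∈ Fl (fun l => l.toFinset = S ∧ l.Nodup) ∧ (S.Nonempty → f ∈ J (yS S))

lemma good_δ {S : Finset X} {f : FreeAlgebra ℤ X} (hf : Good S f) {i : X} (hi : i ∈ S) :
    Good (S.erase i) (δ i f) := by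
  obtain ⟨hf, hJ⟩ := hf
  have hJ := hJ ⟨i, hi⟩
  have hd : ∀ j, δ j f ∈ Fl (fun l => l.toFinset = S.erase j ∧ l.Nodup) := by
    intro i
    refine Fl_map (δ i) _ (fun l hl => ?_) hf
    cases l with
    | nil => simp [W_nil, δ_nil]
    | cons a t =>
      rw [δ_W]
      split_ifs with h
      · subst h
        refine W_mem_Fl ?_
        obtain ⟨h1, h2⟩ := hl
        rw [List.toFinset_cons] at h1
        rw [List.nodup_cons] at h2
        rw [← h1, Finset.erase_insert (by simpa using h2.1)]
        exact ⟨rfl, h2.2⟩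
      · exact Submodule.zero_mem _
  refine ⟨hd i, ?_⟩
  rintro ⟨j, hj⟩
  have hji := Finset.ne_of_mem_erase hj
  have hjS := Finset.mem_of_mem_erase hj
  have h1 := J_hom (sb i 0) (δ_sub_J hi hjS hJ)
  have h2 : sb i 0 (δ j f) = 0 := by
    apply sb_zero
    refine Fl_mono (fun l hl => ?_) (hd j)
    rw [← List.mem_toFinset, hl.1]
    exact Finset.mem_erase.2 ⟨hji.symm, hi⟩
  have h4 : sb i 0 (δ i f) = δ i f := by
    apply sb_fix
    refine Fl_mono (fun l hl => ?_) (hd i)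
    rw [← List.mem_toFinset, hl.1]; simp
  rw [sb_y hi, zero_add, map_sub, h2, sub_zero, h4] at h1
  exact h1

lemma good_swap {S : Finset X} {f : FreeAlgebra ℤ X} (hf : Good S f) {a b : X}
    (ha : a ∈ S) (hb : b ∈ S) (v : List X) :
    bW.repr f (a :: b :: v) = - bW.repr f (b :: a :: v) := by
  have hJ := hf.2 ⟨a, ha⟩
  have h2 : ∀ c d : X, ∀ v, bW.repr (δ c (δ d f)) v = bW.repr f (d :: c :: v) := by
    intro c d v; rw [δ_coord, δ_coord]
  have hz : ∀ c, δ c (δ c f) = 0 := by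
    intro c
    apply bW.repr.injective
    ext v
    rw [h2, map_zero, Finsupp.zero_apply]
    by_contra h
    have := (mem_Fl_iff.1 hf.1 _ h).2
    simp at this
  have hk := δ_sub_J ha hb (δ_sub_J ha hb hJ)
  rw [map_sub, map_sub, hz, hz, zero_sub, sub_zero] at hk
  have := J_no ha ?_ hk
  · have h3 := congrArg (fun z => bW.repr z v) this
    simp only [map_sub, map_neg, map_zero, Finsupp.sub_apply, Finsupp.neg_apply, Finsupp.zero_apply,
      h2] at h3
    linarith
  · rw [mem_Fl_iff]
    intro l hl hal
    simp only [map_sub, map_neg, Finsupp.sub_apply, Finsupp.neg_apply, h2] at hl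
    have : bW.repr f (b :: a :: l) = 0 := by
      by_contra h
      have := (mem_Fl_iff.1 hf.1 _ h).2
      simp [hal] at this
    have h' : bW.repr f (a :: b :: l) = 0 := by
      by_contra h
      have := (mem_Fl_iff.1 hf.1 _ h).2
      simp [hal] at this
    simp [this, h'] at hl

noncomputable def E : FreeAlgebra ℤ X →ₐ[ℤ] ExteriorAlgebra ℤ (X → ℤ) :=
  FreeAlgebra.lift ℤ (fun i => ExteriorAlgebra.ι ℤ (Pi.single i 1))

lemma E_ι (i : X) : E (FreeAlgebra.ι ℤ i) = ExteriorAlgebra.ι ℤ (Pi.single i 1) := by simp [E]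

lemma anti {M : Type*} [AddCommGroup M] (v w : M) :
    ExteriorAlgebra.ι ℤ v * ExteriorAlgebra.ι ℤ w = -(ExteriorAlgebra.ι ℤ w * ExteriorAlgebra.ι ℤ v) :=
  eq_neg_of_add_eq_zero_left (ExteriorAlgebra.ι_add_mul_swap v w)

lemma perm_sign {l₁ l₂ : List X} (h : l₁.Perm l₂) (hnd : l₁.Nodup) : ∃ ε : ℤ,
    (ε * ε = 1) ∧ (∀ f, Good l₁.toFinset f → bW.repr f l₁ = ε * bW.repr f l₂) ∧
    E (W l₁) = ε • E (W l₂) := by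
  induction h with
  | nil => exact ⟨1, by simp⟩
  | @cons a l₁ l₂ h ih =>
    rw [List.nodup_cons] at hnd
    obtain ⟨ε, h0, h1, h2⟩ := ih hnd.2
    refine ⟨ε, h0, fun f hf => ?_, ?_⟩
    · rw [← δ_coord, ← δ_coord]
      apply h1
      have := good_δ hf (i := a) (by simp)
      rwa [List.toFinset_cons, Finset.erase_insert (by simpa using hnd.1)] at this
    · rw [W_cons, W_cons, map_mul, map_mul, h2, mul_smul_comm]
  | @swap a b l =>
    refine ⟨-1, by simp, fun f hf => ?_, ?_⟩
    · rw [good_swap hf (a := b) (b := a) (by simp) (by simp)]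
      simp
    · rw [W_cons, W_cons, W_cons, W_cons, map_mul, map_mul, map_mul, map_mul, E_ι, E_ι,
        ← mul_assoc, ← mul_assoc, anti]
      simp
  | @trans l₁ l₂ l₃ h12 h23 ih1 ih2 =>
    obtain ⟨ε, h0, h1, h2⟩ := ih1 hnd
    obtain ⟨η, k0, k1, k2⟩ := ih2 (h12.nodup_iff.1 hnd)
    refine ⟨ε * η, by linear_combination (η * η) * h0 + k0, fun f hf => ?_, ?_⟩
    · rw [h1 f hf, k1 f (by rwa [← List.toFinset_eq_of_perm _ _ h12]), mul_assoc]
    · rw [h2, k2, smul_smul]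


noncomputable def altF (n : ℕ) (i : ℕ) : (Fin n → ℤ) [⋀^Fin i]→ₗ[ℤ] ℤ :=
  if h : i = n then by subst h; exact Matrix.detRowAlternating else 0

noncomputable def Φ (n : ℕ) : ExteriorAlgebra ℤ (Fin n → ℤ) →ₗ[ℤ] ℤ :=
  ExteriorAlgebra.liftAlternating (altF n)

lemma altF_ne {n i : ℕ} (h : i ≠ n) : altF n i = 0 := by simp [altF, h]
lemma altF_self (n : ℕ) : altF n n = Matrix.detRowAlternating := by simp [altF]

lemma E_W {n : ℕ} (l : List (Fin n)) : E (W l) =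
    ExteriorAlgebra.ιMulti ℤ l.length (fun k => Pi.single (l.get k) (1 : ℤ)) := by
  rw [ExteriorAlgebra.ιMulti_apply]
  have : List.ofFn (fun k : Fin l.length => ExteriorAlgebra.ι ℤ (Pi.single (l.get k) (1 : ℤ)))
      = l.map (fun i => ExteriorAlgebra.ι ℤ (Pi.single i (1 : ℤ))) := by
    conv_rhs => rw [← List.ofFn_get l]
    rw [List.map_ofFn]
    rfl
  rw [this, W, map_list_prod, List.map_map]
  congr 1
  exact List.map_congr_left (fun i _ => E_ι i)

lemma Φ_ne {n : ℕ} {l : List (Fin n)} (h : l.length ≠ n) : Φ n (E (W l)) = 0 := by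
  rw [E_W, Φ, ExteriorAlgebra.liftAlternating_apply_ιMulti, altF_ne h]; rfl

lemma Φ_id (n : ℕ) : Φ n (E (W (List.finRange n))) = 1 := by
  have : E (W (List.finRange n)) =
      ExteriorAlgebra.ιMulti ℤ n (fun k => Pi.single k (1 : ℤ)) := by
    rw [ExteriorAlgebra.ιMulti_apply, W, map_list_prod, List.map_map, List.ofFn_eq_map]
    congr 1
    refine List.map_congr_left (fun i _ => ?_)
    exact E_ι i
  rw [this, Φ, ExteriorAlgebra.liftAlternating_apply_ιMulti, altF_self]
  have h : (fun k => Pi.single k (1 : ℤ)) = (1 : Matrix (Fin n) (Fin n) ℤ) := by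
    ext i j; simp [Matrix.one_apply, Pi.single_apply, eq_comm]
  rw [h]
  exact Matrix.det_one

attribute [local instance 100] LieRing.ofAssociativeRing

section Lie
variable {M : Type*} [AddCommGroup M]

noncomputable def Q2 (M : Type*) [AddCommGroup M] : Submodule ℤ (ExteriorAlgebra ℤ M) :=
  Submodule.span ℤ {q | ∃ v w : M, q = ExteriorAlgebra.ι ℤ v * ExteriorAlgebra.ι ℤ w}

lemma Q2_comm (u : M) {q : ExteriorAlgebra ℤ M} (hq : q ∈ Q2 M) :
    Commute (ExteriorAlgebra.ι ℤ u) q := by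
  refine Submodule.span_induction (p := fun q _ => Commute (ExteriorAlgebra.ι ℤ u) q)
    ?_ ?_ ?_ ?_ hq
  · rintro _ ⟨v, w, rfl⟩
    unfold Commute SemiconjBy
    rw [← mul_assoc, anti u v, neg_mul, mul_assoc, anti u w, mul_neg, neg_neg, mul_assoc]
  · exact Commute.zero_right _
  · intro x y _ _ hx hy; exact hx.add_right hy
  · intro c x _ hx; exact hx.smul_right c

lemma Q2_comm' {q q' : ExteriorAlgebra ℤ M} (hq : q ∈ Q2 M) (hq' : q' ∈ Q2 M) :
    Commute q' q := by
  refine Submodule.span_induction (p := fun q' _ => Commute q' q)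
    ?_ ?_ ?_ ?_ hq'
  · rintro _ ⟨v, w, rfl⟩
    exact (Q2_comm v hq).mul_left (Q2_comm w hq)
  · exact Commute.zero_left _
  · intro x y _ _ hx hy; exact hx.add_left hy
  · intro c x _ hx; exact hx.smul_left c

noncomputable def K2 (M : Type*) [AddCommGroup M] : LieSubalgebra ℤ (ExteriorAlgebra ℤ M) where
  toSubmodule := LinearMap.range (ExteriorAlgebra.ι ℤ (M := M)) ⊔ Q2 M
  lie_mem' := by
    intro x y hx hy
    change x ∈ LinearMap.range (ExteriorAlgebra.ι ℤ (M := M)) ⊔ Q2 M at hx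
    change y ∈ LinearMap.range (ExteriorAlgebra.ι ℤ (M := M)) ⊔ Q2 M at hy
    change ⁅x, y⁆ ∈ LinearMap.range (ExteriorAlgebra.ι ℤ (M := M)) ⊔ Q2 M
    obtain ⟨_, ⟨v, rfl⟩, q, hq, rfl⟩ := Submodule.mem_sup.1 hx
    obtain ⟨_, ⟨w, rfl⟩, r, hr, rfl⟩ := Submodule.mem_sup.1 hy
    apply Submodule.mem_sup_right
    have h1 := (Q2_comm v hr).eq
    have h2 := (Q2_comm w hq).eq
    have h3 := (Q2_comm' hr hq).eq
    have h : ⁅ExteriorAlgebra.ι ℤ v + q, ExteriorAlgebra.ι ℤ w + r⁆ =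
        ExteriorAlgebra.ι ℤ v * ExteriorAlgebra.ι ℤ w
          - ExteriorAlgebra.ι ℤ w * ExteriorAlgebra.ι ℤ v := by
      rw [LieRing.of_associative_ring_bracket, add_mul, mul_add, mul_add, add_mul, mul_add, mul_add,
        h1, h2, h3]
      abel
    rw [h]
    exact Submodule.sub_mem _ (Submodule.subset_span ⟨v, w, rfl⟩) (Submodule.subset_span ⟨w, v, rfl⟩)

end Lie

lemma Φ_K2 {n : ℕ} (hn : 3 ≤ n) {x : ExteriorAlgebra ℤ (Fin n → ℤ)} (hx : x ∈ K2 (Fin n → ℤ)) :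
    Φ n x = 0 := by
  change x ∈ LinearMap.range (ExteriorAlgebra.ι ℤ (M := Fin n → ℤ)) ⊔ Q2 _ at hx
  obtain ⟨_, ⟨v, rfl⟩, q, hq, rfl⟩ := Submodule.mem_sup.1 hx
  rw [map_add, Φ, ExteriorAlgebra.liftAlternating_ι, altF_ne (by omega)]
  have : q ∈ LinearMap.ker (ExteriorAlgebra.liftAlternating (altF n)) := by
    refine (Submodule.span_le.2 ?_ : Q2 _ ≤ _) hq
    rintro _ ⟨v, w, rfl⟩
    rw [SetLike.mem_coe, LinearMap.mem_ker, ExteriorAlgebra.liftAlternating_ι_mul,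
      ExteriorAlgebra.liftAlternating_ι, altF_ne (show Nat.succ 1 ≠ n by omega)]
    rfl
  rw [LinearMap.mem_ker.1 this]
  rfl


section Zlift
variable {Y : Type*} {N : Type*} [LieRing N]

noncomputable def liftZ (g : Y → N) : FreeLieAlgebra ℤ Y →ₗ⁅ℤ⁆ N where
  toFun := FreeLieAlgebra.lift ℤ g
  map_add' := fun x y => map_add (FreeLieAlgebra.lift ℤ g) x y
  map_smul' := fun c x => map_zsmul (FreeLieAlgebra.lift ℤ g) c x
  map_lie' := fun {x y} => LieHom.map_lie (FreeLieAlgebra.lift ℤ g) x y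

lemma liftZ_of (g : Y → N) (i : Y) : liftZ g (FreeLieAlgebra.of ℤ i) = g i :=
  FreeLieAlgebra.lift_of_apply g i

lemma extZ {p q : FreeLieAlgebra ℤ Y →ₗ⁅ℤ⁆ N}
    (h : ∀ i, p (FreeLieAlgebra.of ℤ i) = q (FreeLieAlgebra.of ℤ i)) (a : FreeLieAlgebra ℤ Y) :
    p a = q a := by
  let conv : (FreeLieAlgebra ℤ Y →ₗ⁅ℤ⁆ N) →
      @LieHom ℤ (FreeLieAlgebra ℤ Y) N _ _ (FreeLieAlgebra.instLieAlgebra ℤ Y) _ _ := fun p =>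
    letI := FreeLieAlgebra.instLieAlgebra ℤ Y
    { toFun := p
      map_add' := fun x y => map_add p x y
      map_smul' := fun c x => map_zsmul p c x
      map_lie' := fun {x y} => LieHom.map_lie p x y }
  have : conv p = conv q := FreeLieAlgebra.hom_ext (fun i => h i)
  exact DFunLike.congr_fun this a

end Zlift

noncomputable def AA (n : ℕ) :
    UniversalEnvelopingAlgebra ℤ (FreeLieAlgebra ℤ (Fin n)) ≃ₐ[ℤ] FreeAlgebra ℤ (Fin n) :=
  AlgEquiv.ofAlgHom
    (UniversalEnvelopingAlgebra.lift ℤ (liftZ (FreeAlgebra.ι ℤ)))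
    (FreeAlgebra.lift ℤ (fun i => UniversalEnvelopingAlgebra.ι ℤ (FreeLieAlgebra.of ℤ i)))
    (by
      apply FreeAlgebra.hom_ext
      funext i
      simp only [AlgHom.comp_apply, Function.comp_apply, FreeAlgebra.lift_ι_apply,
        AlgHom.id_apply]
      exact (UniversalEnvelopingAlgebra.lift_ι_apply ℤ _ _).trans (liftZ_of _ i))
    (by
      apply UniversalEnvelopingAlgebra.hom_ext
      apply LieHom.ext
      refine extZ (fun i => ?_)
      change FreeAlgebra.lift ℤ _ (UniversalEnvelopingAlgebra.lift ℤ (liftZ (FreeAlgebra.ι ℤ))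
        (UniversalEnvelopingAlgebra.ι ℤ (FreeLieAlgebra.of ℤ i))) =
        UniversalEnvelopingAlgebra.ι ℤ (FreeLieAlgebra.of ℤ i)
      exact (congrArg _ ((UniversalEnvelopingAlgebra.lift_ι_apply ℤ _ _).trans
        (liftZ_of _ i))).trans (FreeAlgebra.lift_ι_apply _ _))

lemma AA_ι (n : ℕ) (a : FreeLieAlgebra ℤ (Fin n)) :
    AA n (UniversalEnvelopingAlgebra.ι ℤ a) = liftZ (FreeAlgebra.ι ℤ) a :=
  UniversalEnvelopingAlgebra.lift_ι_apply ℤ _ _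

lemma AA_symm (n : ℕ) (i : Fin n) : (AA n).symm (FreeAlgebra.ι ℤ i) =
    UniversalEnvelopingAlgebra.ι ℤ (FreeLieAlgebra.of ℤ i) := by
  simp [AA]

lemma Φ_lie {n : ℕ} (hn : 3 ≤ n) (a : FreeLieAlgebra ℤ (Fin n)) :
    Φ n (E (AA n (UniversalEnvelopingAlgebra.ι ℤ a))) = 0 := by
  apply Φ_K2 hn
  rw [AA_ι]
  let g : Fin n → K2 (Fin n → ℤ) := fun i => ⟨ExteriorAlgebra.ι ℤ (Pi.single i 1),
    Submodule.mem_sup_left ⟨_, rfl⟩⟩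
  let p : FreeLieAlgebra ℤ (Fin n) →ₗ⁅ℤ⁆ ExteriorAlgebra ℤ (Fin n → ℤ) :=
    { toFun := fun a => E (liftZ (FreeAlgebra.ι ℤ) a)
      map_add' := fun x y => by rw [map_add, map_add]
      map_smul' := fun c x => by
        rw [map_zsmul, map_zsmul]; rfl
      map_lie' := fun {x y} => by
        rw [LieHom.map_lie, LieRing.of_associative_ring_bracket, map_sub, map_mul, map_mul,
          LieRing.of_associative_ring_bracket] }
  let q : FreeLieAlgebra ℤ (Fin n) →ₗ⁅ℤ⁆ ExteriorAlgebra ℤ (Fin n → ℤ) :=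
    { toFun := fun a => ((liftZ g a : K2 (Fin n → ℤ)) : ExteriorAlgebra ℤ (Fin n → ℤ))
      map_add' := fun x y => by rw [map_add]; rfl
      map_smul' := fun c x => by rw [map_zsmul]; rfl
      map_lie' := fun {x y} => by rw [LieHom.map_lie]; rfl }
  have h2 : p a = q a := by
    refine extZ (fun i => ?_) a
    change E (liftZ (FreeAlgebra.ι ℤ) (FreeLieAlgebra.of ℤ i)) =
      ((liftZ g (FreeLieAlgebra.of ℤ i) : K2 (Fin n → ℤ)) : ExteriorAlgebra ℤ (Fin n → ℤ))
    rw [liftZ_of, liftZ_of, E_ι]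
  change p a ∈ _
  rw [h2]
  exact (liftZ g a).2

lemma mem_J_of_lieSpan {n : ℕ} {x a : FreeLieAlgebra ℤ (Fin n)}
    (ha : a ∈ LieSubmodule.lieSpan ℤ (FreeLieAlgebra ℤ (Fin n)) {x}) :
    AA n (UniversalEnvelopingAlgebra.ι ℤ a) ∈ J (AA n (UniversalEnvelopingAlgebra.ι ℤ x)) := by
  refine LieSubmodule.lieSpan_induction ℤ (FreeLieAlgebra ℤ (Fin n))
    (p := fun a _ => AA n (UniversalEnvelopingAlgebra.ι ℤ a) ∈
      J (AA n (UniversalEnvelopingAlgebra.ι ℤ x))) ?_ ?_ ?_ ?_ ?_ ha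
  · rintro _ rfl
    simpa [W_nil] using mem_J (AA n (UniversalEnvelopingAlgebra.ι ℤ _)) [] []
  · rw [map_zero, map_zero]; exact Submodule.zero_mem _
  · intro u v _ _ hu hv
    rw [map_add, map_add]; exact Submodule.add_mem _ hu hv
  · intro c u _ hu
    rw [map_zsmul, map_zsmul]; exact zsmul_mem hu c
  · intro u v _ hv
    rw [LieHom.map_lie, LieRing.of_associative_ring_bracket, map_sub, map_mul, map_mul]
    refine Submodule.sub_mem _ ?_ ?_
    · simpa using J_mul _ (AA n (UniversalEnvelopingAlgebra.ι ℤ u)) 1 hv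
    · simpa using J_mul _ 1 (AA n (UniversalEnvelopingAlgebra.ι ℤ u)) hv

/-- degree projection -/
noncomputable def Dg (n : ℕ) : FreeAlgebra ℤ X →ₗ[ℤ] FreeAlgebra ℤ X :=
  bW.constr ℤ (fun l => if l.length = n then W l else 0)

lemma Dg_W (n : ℕ) (l : List X) : Dg n (W l) = if l.length = n then W l else 0 := by
  conv_lhs => rw [← bW_apply]
  rw [Dg, Basis.constr_basis]

lemma Dg_J (n : ℕ) (S : Finset X) {f : FreeAlgebra ℤ X} (hf : f ∈ J (yS S)) :
    Dg n f ∈ J (yS S) := by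
  refine J_map (Dg n) _ (fun l r => ?_) hf
  have h : W l * yS S * W r = ∑ i ∈ S, W (l ++ i :: r) := by
    simp [yS, Finset.mul_sum, Finset.sum_mul, W_append, W_cons, mul_assoc]
  have h2 : Dg n (W l * yS S * W r) =
      if l.length + (r.length + 1) = n then W l * yS S * W r else 0 := by
    rw [h, map_sum]
    simp only [Dg_W, List.length_append, List.length_cons]
    split_ifs <;> simp
  rw [h2]
  split_ifs
  · exact mem_J _ _ _
  · exact Submodule.zero_mem _

lemma good_zero {n : ℕ} {f : FreeAlgebra ℤ (Fin n)} (hf : Good Finset.univ f)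
    (hΦ : Φ n (E f) = 0) : f = 0 := by
  have hl0 : (List.finRange n).Nodup := List.nodup_finRange n
  have huniv : (List.finRange n).toFinset = Finset.univ := by ext; simp
  have hp : ∀ l, bW.repr f l ≠ 0 → (List.finRange n).Perm l := by
    intro l hl
    obtain ⟨h1, h2⟩ := mem_Fl_iff.1 hf.1 l hl
    exact List.perm_of_nodup_nodup_toFinset_eq hl0 h2 (by rw [huniv, h1])
  have key : bW.repr f (List.finRange n) = 0 := by
    by_contra hc
    have hsum : f = ∑ l ∈ (bW.repr f).support, bW.repr f l • W l := by
      conv_lhs => rw [← bW.linearCombination_repr f, Finsupp.linearCombination_apply, Finsupp.sum]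
      simp only [bW_apply]
    have h2 : Φ n (E f) = ∑ l ∈ (bW.repr f).support, bW.repr f (List.finRange n) := by
      conv_lhs => rw [hsum]
      rw [map_sum, map_sum]
      refine Finset.sum_congr rfl (fun l hl => ?_)
      obtain ⟨ε, h0, h1, h2⟩ := perm_sign (hp l (by simpa using hl)) hl0
      have h3 := Φ_id n
      rw [h2, map_smul, smul_eq_mul] at h3
      rw [map_smul, map_smul, smul_eq_mul, h1 f (by rw [huniv]; exact hf)]
      linear_combination (bW.repr f l * ε) * h3 - (bW.repr f l * Φ n (E (W l))) * h0
    rw [hΦ, Finset.sum_const, nsmul_eq_mul, eq_comm, mul_eq_zero] at h2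
    rcases h2 with h2 | h2
    · simp only [Nat.cast_eq_zero, Finset.card_eq_zero] at h2
      have : List.finRange n ∈ (bW.repr f).support := by simpa using hc
      rw [h2] at this
      simp at this
    · exact hc h2
  apply bW.repr.injective
  ext l
  rw [map_zero, Finsupp.zero_apply]
  by_contra hl
  obtain ⟨ε, h0, h1, h2⟩ := perm_sign (hp l hl) hl0
  rw [h1 f (by rw [huniv]; exact hf)] at key
  rcases mul_eq_zero.1 key with h | h
  · simp [h] at h0
  · exact hl h

lemma iIdeal_left {n : ℕ} (i : Fin (n + 1)) : (⊤ : Submodule ℤ _) * iIdeal n i ≤ iIdeal n i := by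
  rw [Submodule.mul_le]
  intro m _ x hx
  refine Submodule.span_induction (p := fun x _ => m * x ∈ iIdeal n i) ?_ ?_ ?_ ?_ hx
  · rintro _ ⟨a, b, rfl⟩
    exact Submodule.subset_span ⟨m * a, b, by simp only [mul_assoc]⟩
  · simp
  · intro x y _ _ h1 h2; rw [mul_add]; exact Submodule.add_mem _ h1 h2
  · intro c x _ h; rw [mul_smul_comm]; exact Submodule.smul_mem _ _ h

lemma iIdeal_right {n : ℕ} (i : Fin (n + 1)) : iIdeal n i * (⊤ : Submodule ℤ _) ≤ iIdeal n i := by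
  rw [Submodule.mul_le]
  intro x hx m _
  refine Submodule.span_induction (p := fun x _ => x * m ∈ iIdeal n i) ?_ ?_ ?_ ?_ hx
  · rintro _ ⟨a, b, rfl⟩
    exact Submodule.subset_span ⟨a, b * m, by simp only [mul_assoc]⟩
  · simp
  · intro x y _ _ h1 h2; rw [add_mul]; exact Submodule.add_mem _ h1 h2
  · intro c x _ h; rw [smul_mul_assoc]; exact Submodule.smul_mem _ _ h

noncomputable def xU (n : ℕ) (i : Fin (n + 1)) :
    UniversalEnvelopingAlgebra ℤ (FreeLieAlgebra ℤ (Fin n)) := UniversalEnvelopingAlgebra.ι ℤ (xL n i)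

lemma xU_mem {n : ℕ} (i : Fin (n + 1)) : xU n i ∈ iIdeal n i :=
  Submodule.subset_span ⟨1, 1, by simp [xU]⟩

lemma mmono {n : ℕ}
    {P Q R S : Submodule ℤ (UniversalEnvelopingAlgebra ℤ (FreeLieAlgebra ℤ (Fin n)))}
    (h : P ≤ Q) (h' : R ≤ S) : P * R ≤ Q * S :=
  Submodule.mul_le.2 (fun _ hm _ hn => Submodule.mul_mem_mul (h hm) (h' hn))

lemma sublist_mem {n : ℕ} {l w : List (Fin (n + 1))} (h : l.Sublist w) :
    (w.map (xU n)).prod ∈ (l.map (iIdeal n)).prod * (⊤ : Submodule ℤ _) := by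
  induction h with
  | slnil =>
    rw [List.map_nil, List.map_nil, List.prod_nil, List.prod_nil, Submodule.one_mul]
    exact Submodule.mem_top
  | @cons l w a h ih =>
    rw [List.map_cons, List.prod_cons]
    cases l with
    | nil => rw [List.map_nil, List.prod_nil, Submodule.one_mul]; exact Submodule.mem_top
    | cons b t =>
      rw [List.map_cons, List.prod_cons, mul_assoc] at ih ⊢
      have := Submodule.mul_mem_mul (Submodule.mem_top : xU n a ∈ ⊤) ih
      rw [← mul_assoc] at this
      exact mmono (iIdeal_left b) le_rfl this
  | @cons_cons l w a h ih =>
    rw [List.map_cons, List.prod_cons, List.map_cons, List.prod_cons, mul_assoc]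
    exact Submodule.mul_mem_mul (xU_mem a) ih

lemma prod_top {n : ℕ} {l : List (Fin (n + 1))} (h : l ≠ []) :
    (l.map (iIdeal n)).prod * (⊤ : Submodule ℤ _) ≤ (l.map (iIdeal n)).prod := by
  induction l with
  | nil => exact absurd rfl h
  | cons a t ih =>
    rw [List.map_cons, List.prod_cons]
    cases t with
    | nil => rw [List.map_nil, List.prod_nil, show iIdeal n a * 1 = iIdeal n a from Submodule.mul_one _]; exact iIdeal_right a
    | cons b t =>
      rw [mul_assoc]
      exact mmono le_rfl (ih (by simp))

lemma word_mem {n : ℕ} (w : List (Fin (n + 1))) (hw : ∀ i, i ∈ w) :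
    (w.map (xU n)).prod ∈ symProdLie n := by
  have hnd := List.nodup_dedup w
  have hmem : ∀ i, i ∈ w.dedup := fun i => List.mem_dedup.2 (hw i)
  have h1 := prod_top (List.ne_nil_of_mem (hmem 0)) (sublist_mem (List.dedup_sublist w))
  have hlen : w.dedup.length = n + 1 := by
    rw [← List.toFinset_card_of_nodup hnd]
    have : w.dedup.toFinset = Finset.univ := by ext i; simpa using hw i
    rw [this]; simp
  let ρ : Equiv.Perm (Fin (n + 1)) :=
    (finCongr hlen.symm).trans (hnd.getEquivOfForallMemList _ hmem)
  refine Submodule.mem_iSup_of_mem ρ ?_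
  convert h1 using 2
  apply List.ext_get
  · simp [hlen]
  · intro k h1 h2
    rw [List.get_ofFn]
    simp [ρ]
    rfl

lemma xU_castSucc {n : ℕ} (i : Fin n) : xU n i.castSucc = (AA n).symm (FreeAlgebra.ι ℤ i) := by
  rw [AA_symm, xU, xL]
  simp

lemma xU_last (n : ℕ) : xU n (Fin.last n) = - (AA n).symm (yS Finset.univ) := by
  rw [yS, map_sum, xU, xL]
  simp [AA_symm]

lemma Sm_mem {n : ℕ} {f : FreeAlgebra ℤ (Fin n)} (hf : f ∈ Sm Finset.univ) :
    (AA n).symm f ∈ symProdLie n := by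
  refine Submodule.span_induction (p := fun f _ => (AA n).symm f ∈ symProdLie n) ?_ ?_ ?_ ?_ hf
  · rintro _ ⟨l, r, hlr, rfl⟩
    have hW : ∀ l : List (Fin n), (AA n).symm (W l) = ((l.map Fin.castSucc).map (xU n)).prod := by
      intro l
      rw [W, map_list_prod, List.map_map, List.map_map]
      congr 1
      exact List.map_congr_left (fun i _ => (xU_castSucc i).symm)
    have h := word_mem (n := n) (l.map Fin.castSucc ++ Fin.last n :: r.map Fin.castSucc) ?_
    · rw [List.map_append, List.map_cons, List.prod_append, List.prod_cons, ← hW, ← hW, xU_last] at h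
      rw [map_mul, map_mul]
      have h' := Submodule.neg_mem _ h
      convert h' using 1
      noncomm_ring
    · intro i
      refine Fin.lastCases (by simp) (fun j => ?_) i
      have : j ∈ (l ++ r).toFinset := by rw [hlr]; simp
      simp only [List.mem_toFinset, List.mem_append] at this
      rcases this with h | h <;> simp [h]
  · simp
  · intro x y _ _ hx hy; rw [map_add]; exact Submodule.add_mem _ hx hy
  · intro c x _ hx; rw [map_smul]; exact Submodule.smul_mem _ _ hx

end SymP

open SymP

/-- For `n ≥ 3`, every element of `I_0 ∩ ⋯ ∩ I_n` has image under `L → U(L)` lying in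
the symmetric product `(𝔦_0, …, 𝔦_n)_Σ`. -/
theorem lie_intersection_sub_symmetric_product (n : ℕ) (hn : 3 ≤ n)
    (a : FreeLieAlgebra ℤ (Fin n)) (ha : ∀ i : Fin (n + 1), a ∈ ILie n i) :
    UniversalEnvelopingAlgebra.ι ℤ a ∈ symProdLie n := by
  set f := AA n (UniversalEnvelopingAlgebra.ι ℤ a) with hf
  have hJ : ∀ i, f ∈ J (AA n (xU n i)) := fun i => mem_J_of_lieSpan (ha i)
  have hJy : f ∈ J (yS Finset.univ) := by
    have h := hJ (Fin.last n)
    rw [xU_last, map_neg, AlgEquiv.apply_symm_apply] at h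
    refine J_map LinearMap.id _ (fun l r => ?_) h
    have := Submodule.neg_mem _ (mem_J (yS (Finset.univ : Finset (Fin n))) l r)
    simpa using this
  have hfull : f ∈ Fl (fun l => l.toFinset = Finset.univ) := by
    rw [mem_Fl_iff]
    intro l hl
    ext i
    simp only [List.mem_toFinset, Finset.mem_univ, iff_true]
    have h := hJ i.castSucc
    rw [xU_castSucc, AlgEquiv.apply_symm_apply] at h
    exact mem_Fl_iff.1 (J_ι i h) l hl
  have hcard : ∀ l : List (Fin n), l.toFinset = Finset.univ → l.dedup.length = n := by
    intro l hl
    rw [← List.card_toFinset, hl]; simp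
  have h1 : Dg n f ∈ Fl (fun l => l.toFinset = Finset.univ ∧ l.Nodup) := by
    refine Fl_map (Dg n) _ (fun l hl => ?_) hfull
    rw [Dg_W]
    split_ifs with h
    · refine W_mem_Fl ⟨hl, ?_⟩
      rw [← List.dedup_eq_self]
      exact (List.dedup_sublist l).eq_of_length (by rw [hcard l hl, h])
    · exact Submodule.zero_mem _
  have h2 : f - Dg n f ∈ Fl (fun l => l.toFinset = Finset.univ ∧
      (Finset.univ : Finset (Fin n)).card < l.length) := by
    refine Fl_map (LinearMap.id - Dg n) _ (fun l hl => ?_) hfull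
    rw [LinearMap.sub_apply, LinearMap.id_apply, Dg_W]
    split_ifs with h
    · simp
    · rw [sub_zero]
      refine W_mem_Fl ⟨hl, ?_⟩
      have := (List.dedup_sublist l).length_le
      rw [hcard l hl] at this
      rw [Finset.card_univ, Fintype.card_fin]
      omega
  have h3 : Φ n (E (f - Dg n f)) = 0 := by
    have := Fl_map ((Φ n).comp (E (X := Fin n)).toLinearMap) ⊥ (fun l hl => ?_) h2
    · exact this
    · refine Φ_ne (l := l) ?_
      have := hl.2
      rw [Finset.card_univ, Fintype.card_fin] at this
      omega
  have h4 : Dg n f = 0 := by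
    refine good_zero ⟨h1, fun _ => Dg_J n _ hJy⟩ ?_
    rw [map_sub, map_sub, hf, Φ_lie hn a, zero_sub, neg_eq_zero] at h3
    exact h3
  rw [h4, sub_zero] at h2
  have h5 := Sm_mem (thmA _ _ rfl f h2 hJy)
  rwa [hf, AlgEquiv.symm_apply_apply] at h5
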